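/- arXiv:1303.0806 — 2 statements merged into one kernel-verified Lean document; each statement's English description precedes it below -/
import Mathlib

section
/- For all N ≥ 0 and n ≥ 0, the coefficient of t^N in the polynomial P (2n+N) equals c₀ · T_N(n). That is, the part of the solution of the three-term recurrence relation containing exactly N factors from the sequence A contributes to the coefficient of index 2n+N, and is given by the nested sum T_N(n) over nondecreasing index tuples. -/
/-- `T A B N n` is the nested sum `T_N(n)`:
for `N = 0` it is `∏_{j=0}^{n-1} B (2j+1)`, and for `N ≥ 1` it is the sum over all
nondecreasing tuples `0 ≤ i_1 ≤ ⋯ ≤ i_N ≤ n` of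
`(∏_{k=1}^{N} A (2 i_k + k - 1)) * (∏_{l=0}^{N-1} ∏_{j=i_l}^{i_{l+1}-1} B (2j+l+1)) *
 (∏_{j=i_N}^{n-1} B (2j+N+1))` with the convention `i_0 = 0`. -/
def T {R : Type*} [CommRing R] (A B : ℕ → R) : ℕ → ℕ → R
  | 0, n => ∏ j ∈ Finset.range n, B (2 * j + 1)
  | N + 1, n =>
      ∑ i ∈ Finset.univ.filter
          (fun i : Fin (N + 1) → Fin (n + 1) => ∀ a b, a ≤ b → i a ≤ i b),
        (fun e : ℕ → ℕ =>
          (∏ k ∈ Finset.range (N + 1), A (2 * e (k + 1) + k)) *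
          (∏ l ∈ Finset.range (N + 1), ∏ j ∈ Finset.Ico (e l) (e (l + 1)), B (2 * j + l + 1)) *
          (∏ j ∈ Finset.Ico (e (N + 1)) n, B (2 * j + (N + 1) + 1)))
        (fun l => if h : 1 ≤ l ∧ l ≤ N + 1 then (i ⟨l - 1, by omega⟩ : ℕ) else 0)

/-- The nondecreasing `N`-tuples of natural numbers bounded by `n`. -/
def monotoneTuples (N n : ℕ) : Finset (Fin N → ℕ) :=
  (Fintype.piFinset fun _ => Finset.range (n + 1)).filter fun i => ∀ a b, a ≤ b → i a ≤ i b

theorem mem_monotoneTuples {N n : ℕ} {i : Fin N → ℕ} :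
    i ∈ monotoneTuples N n ↔ (∀ a, i a ≤ n) ∧ ∀ a b, a ≤ b → i a ≤ i b := by
  simp [monotoneTuples]

/-- The sequence `0, i_1, …, i_N, 0, 0, …` attached to a tuple `(i_1, …, i_N)`. -/
def extendTuple {N : ℕ} (i : Fin N → ℕ) (l : ℕ) : ℕ :=
  if h : 1 ≤ l ∧ l ≤ N then i ⟨l - 1, by omega⟩ else 0

theorem extendTuple_snoc_of_le {N : ℕ} (i : Fin N → ℕ) (m : ℕ) {l : ℕ} (hl : l ≤ N) :
    extendTuple (Fin.snoc i m : Fin (N + 1) → ℕ) l = extendTuple i l := by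
  unfold extendTuple
  by_cases h : 1 ≤ l
  · have h' : l - 1 < N := by omega
    simp [h, hl, Nat.le_succ_of_le hl, Fin.snoc, h']
  · simp [h]

theorem extendTuple_snoc_last {N : ℕ} (i : Fin N → ℕ) (m : ℕ) :
    extendTuple (Fin.snoc i m : Fin (N + 1) → ℕ) (N + 1) = m := by
  simp [extendTuple, Fin.snoc]

/-- The summand of `T A B N n` belonging to the index sequence `e`. -/
def tupleWeight {R : Type*} [CommRing R] (A B : ℕ → R) (N n : ℕ) (e : ℕ → ℕ) : R :=
  (∏ k ∈ Finset.range N, A (2 * e (k + 1) + k)) *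
    (∏ l ∈ Finset.range N, ∏ j ∈ Finset.Ico (e l) (e (l + 1)), B (2 * j + l + 1)) *
    (∏ j ∈ Finset.Ico (e N) n, B (2 * j + N + 1))

section

variable {R : Type*} [CommRing R] (A B : ℕ → R)

theorem tupleWeight_succ (N n : ℕ) (e : ℕ → ℕ) :
    tupleWeight A B (N + 1) n e = A (2 * e (N + 1) + N) * tupleWeight A B N (e (N + 1)) e *
      ∏ j ∈ Finset.Ico (e (N + 1)) n, B (2 * j + (N + 1) + 1) := by
  simp only [tupleWeight, Finset.prod_range_succ]
  ring

theorem tupleWeight_congr (N n : ℕ) {e e' : ℕ → ℕ} (h : ∀ l ≤ N, e l = e' l) :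
    tupleWeight A B N n e = tupleWeight A B N n e' := by
  unfold tupleWeight
  rw [h N le_rfl]
  congr 2
  · refine Finset.prod_congr rfl fun k hk => ?_
    rw [h (k + 1) (Finset.mem_range.mp hk)]
  · refine Finset.prod_congr rfl fun k hk => ?_
    rw [h (k + 1) (Finset.mem_range.mp hk), h k (Finset.mem_range.mp hk).le]

theorem T_eq_sum_monotoneTuples (N n : ℕ) :
    T A B N n = ∑ i ∈ monotoneTuples N n, tupleWeight A B N n (extendTuple i) := by
  cases N with
  | zero =>
    have h : monotoneTuples 0 n = Finset.univ :=
      Finset.eq_univ_of_forall fun i => by simp [mem_monotoneTuples]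
    simp [h, T, tupleWeight, extendTuple]
  | succ N =>
    refine Finset.sum_bij (fun i _ a => (i a : ℕ)) ?_ ?_ ?_ ?_
    · intro i hi
      rw [mem_monotoneTuples]
      exact ⟨fun a => Nat.lt_succ_iff.mp (i a).2, fun a b hab => (Finset.mem_filter.mp hi).2 a b hab⟩
    · intro i _ i' _ h
      funext a
      exact Fin.ext (congrFun h a)
    · intro i hi
      rw [mem_monotoneTuples] at hi
      refine ⟨fun a => ⟨i a, Nat.lt_succ_iff.mpr (hi.1 a)⟩, ?_, rfl⟩
      exact Finset.mem_filter.mpr ⟨Finset.mem_univ _, hi.2⟩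
    · intro i _
      rfl

theorem T_succ_left (N n : ℕ) :
    T A B (N + 1) n = ∑ m ∈ Finset.range (n + 1), A (2 * m + N) * T A B N m *
      ∏ j ∈ Finset.Ico m n, B (2 * j + (N + 1) + 1) := by
  simp only [T_eq_sum_monotoneTuples, Finset.mul_sum, Finset.sum_mul]
  rw [Finset.sum_sigma']
  symm
  refine Finset.sum_bij' (fun p _ => (Fin.snoc p.2 p.1 : Fin (N + 1) → ℕ))
    (fun i _ => ⟨i (Fin.last N), Fin.init i⟩) ?_ ?_ ?_ ?_ ?_
  · rintro ⟨m, i⟩ hp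
    simp only [Finset.mem_sigma, Finset.mem_range, mem_monotoneTuples] at hp
    obtain ⟨hm, hi, hmono⟩ := hp
    rw [mem_monotoneTuples]
    constructor
    · intro a
      refine Fin.lastCases ?_ (fun a => ?_) a
      · simpa using Nat.lt_succ_iff.mp hm
      · simpa using (hi a).trans (Nat.lt_succ_iff.mp hm)
    · intro a b
      refine Fin.lastCases ?_ (fun a => ?_) a <;> refine Fin.lastCases ?_ (fun b => ?_) b
      · simp
      · intro h
        exact absurd (Fin.castSucc_lt_last b) (not_lt.mpr h)
      · simpa using fun _ => hi a
      · simpa using hmono a b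
  · intro i hi
    rw [mem_monotoneTuples] at hi
    simp only [Finset.mem_sigma, Finset.mem_range, mem_monotoneTuples]
    exact ⟨Nat.lt_succ_iff.mpr (hi.1 _), fun a => hi.2 _ _ (Fin.le_last _),
      fun a b hab => hi.2 _ _ (Fin.castSucc_le_castSucc_iff.mpr hab)⟩
  · rintro ⟨m, i⟩ _
    simp
  · intro i _
    simp
  · rintro ⟨m, i⟩ _
    rw [tupleWeight_succ, extendTuple_snoc_last,
      tupleWeight_congr A B N m fun l hl => extendTuple_snoc_of_le i m hl]

theorem T_zero_succ (n : ℕ) : T A B 0 (n + 1) = B (2 * n + 1) * T A B 0 n := by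
  simp only [T, Finset.prod_range_succ, mul_comm]

theorem T_succ_zero (N : ℕ) : T A B (N + 1) 0 = A N * T A B N 0 := by
  simp [T_succ_left]

theorem T_succ_succ (N n : ℕ) :
    T A B (N + 1) (n + 1) =
      A (2 * (n + 1) + N) * T A B N (n + 1) + B (2 * n + N + 2) * T A B (N + 1) n := by
  rw [T_succ_left, Finset.sum_range_succ, T_succ_left, Finset.mul_sum, add_comm]
  congr 1
  · simp
  · refine Finset.sum_congr rfl fun m hm => ?_
    rw [Finset.prod_Ico_succ_top (Nat.lt_succ_iff.mp (Finset.mem_range.mp hm))]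
    ring_nf

end

theorem coeff_eq_zero_of_three_term_recurrence {R : Type*} [CommRing R] (A B : ℕ → R) (c₀ : R)
    (P : ℕ → Polynomial R)
    (h0 : P 0 = Polynomial.C c₀)
    (h1 : P 1 = Polynomial.X * Polynomial.C (A 0 * c₀))
    (hrec : ∀ n, 1 ≤ n →
      P (n + 1) = Polynomial.X * Polynomial.C (A n) * P n + Polynomial.C (B n) * P (n - 1))
    (m k : ℕ) (hk : m < k) : (P m).coeff k = 0 := by
  induction m using Nat.strong_induction_on generalizing k with
  | _ m ih =>
    obtain ⟨k, rfl⟩ : ∃ l, k = l + 1 := ⟨k - 1, by omega⟩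
    match m with
    | 0 => simp [h0]
    | 1 =>
      rw [h1, Polynomial.coeff_X_mul, Polynomial.coeff_C, if_neg (by omega)]
    | m + 2 =>
      rw [hrec (m + 1) (by omega), Polynomial.coeff_add, mul_assoc, Polynomial.coeff_X_mul,
        Polynomial.coeff_C_mul, Polynomial.coeff_C_mul, ih (m + 1) (by omega) k (by omega),
        Nat.add_sub_cancel, ih m (by omega) _ (by omega)]
      simp

/-- The part of the solution of the three-term recurrence relation containing exactly `N`
`A`-factors contributes to the coefficient of index `2n+N` and equals `c₀ * T_N(n)`. -/
theorem three_term_recurrence_graded_coeff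
    {R : Type*} [CommRing R] (A B : ℕ → R) (c₀ : R) (P : ℕ → Polynomial R)
    (h0 : P 0 = Polynomial.C c₀)
    (h1 : P 1 = Polynomial.X * Polynomial.C (A 0 * c₀))
    (hrec : ∀ n, 1 ≤ n →
      P (n + 1) = Polynomial.X * Polynomial.C (A n) * P n + Polynomial.C (B n) * P (n - 1))
    (N n : ℕ) :
    (P (2 * n + N)).coeff N = c₀ * T A B N n := by
  have hX : ∀ m k, 1 ≤ m → (P (m + 1)).coeff (k + 1) =
      A m * (P m).coeff k + B m * (P (m - 1)).coeff (k + 1) := by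
    intro m k hm
    rw [hrec m hm, Polynomial.coeff_add, mul_assoc, Polynomial.coeff_X_mul,
      Polynomial.coeff_C_mul, Polynomial.coeff_C_mul]
  induction N generalizing n with
  | zero =>
    induction n with
    | zero => simp [h0, T]
    | succ n ih =>
      rw [add_zero] at ih
      rw [show 2 * (n + 1) + 0 = (2 * n + 1) + 1 by ring, hrec _ (by omega), T_zero_succ,
        Nat.add_sub_cancel, Polynomial.coeff_add, mul_assoc, Polynomial.coeff_X_mul_zero,
        Polynomial.coeff_C_mul, ih]
      ring
  | succ N ihN =>
    induction n with
    | zero =>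
      rw [T_succ_zero, mul_left_comm, ← ihN 0, mul_zero, zero_add, zero_add]
      rcases Nat.eq_zero_or_pos N with rfl | hN
      · simp [h0, h1]
      · rw [hX N N hN, coeff_eq_zero_of_three_term_recurrence A B c₀ P h0 h1 hrec (N - 1) (N + 1)
          (by omega), mul_zero, add_zero]
    | succ n ih =>
      rw [← add_assoc, hX _ _ (by omega), ihN, T_succ_succ,
        show 2 * (n + 1) + N - 1 = 2 * n + (N + 1) by omega, ih,
        show 2 * (n + 1) + N = 2 * n + N + 2 by ring]
      ring
end

section
/- For all n ≥ 0, the coefficient of t^2 in the polynomial P (2n+2) equals c₀ · Σ_{i₁=0}^{n} Σ_{i₂=i₁}^{n} A_{2i₁} · A_{2i₂+1} · (∏_{j=0}^{i₁-1} B_{2j+1}) · (∏_{j=i₁}^{i₂-1} B_{2j+2}) · (∏_{j=i₂}^{n-1} B_{2j+3}). That is, the part of the solution of the three-term recurrence relation containing exactly two A-factors appears at even index 2n+2 and is given by this double sum. -/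
open Polynomial in
/-- One step of the recurrence `P (n + 1) = X * C (A n) * P n + C (B n) * P (n - 1)` on
coefficients of positive degree. -/
theorem coeff_succ_of_three_term {R : Type*} [CommRing R] (a b : R) (p q : R[X]) (k : ℕ) :
    (X * C a * p + C b * q).coeff (k + 1) = a * p.coeff k + b * q.coeff (k + 1) := by
  rw [coeff_add, mul_assoc, coeff_X_mul, coeff_C_mul, coeff_C_mul]

/-- The part with no `A`-factors at even index. -/
theorem three_term_recurrence_zero_A_terms
    {R : Type*} [CommRing R] (A B : ℕ → R) (c₀ : R) (P : ℕ → Polynomial R)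
    (h0 : P 0 = Polynomial.C c₀)
    (hrec : ∀ n, 1 ≤ n →
      P (n + 1) = Polynomial.X * Polynomial.C (A n) * P n + Polynomial.C (B n) * P (n - 1))
    (n : ℕ) :
    (P (2 * n)).coeff 0 = c₀ * ∏ j ∈ Finset.range n, B (2 * j + 1) := by
  induction n with
  | zero => simp [h0]
  | succ n ih =>
    rw [show 2 * (n + 1) = 2 * n + 1 + 1 by ring, hrec (2 * n + 1) (by omega),
      Nat.add_sub_cancel, Finset.prod_range_succ]
    simp only [Polynomial.coeff_add, Polynomial.mul_coeff_zero, Polynomial.coeff_X_zero,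
      Polynomial.coeff_C_zero, ih]
    ring

/-- The part with exactly one `A`-factor at odd index. -/
theorem three_term_recurrence_one_A_term
    {R : Type*} [CommRing R] (A B : ℕ → R) (c₀ : R) (P : ℕ → Polynomial R)
    (h0 : P 0 = Polynomial.C c₀)
    (h1 : P 1 = Polynomial.X * Polynomial.C (A 0 * c₀))
    (hrec : ∀ n, 1 ≤ n →
      P (n + 1) = Polynomial.X * Polynomial.C (A n) * P n + Polynomial.C (B n) * P (n - 1))
    (n : ℕ) :
    (P (2 * n + 1)).coeff 1 =
      c₀ * ∑ i ∈ Finset.range (n + 1),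
        A (2 * i) * (∏ j ∈ Finset.range i, B (2 * j + 1)) *
          ∏ j ∈ Finset.Ico i n, B (2 * j + 2) := by
  induction n with
  | zero => simp [h1, mul_comm]
  | succ n ih =>
    have hsum : ∑ i ∈ Finset.range (n + 1),
          A (2 * i) * (∏ j ∈ Finset.range i, B (2 * j + 1)) *
            ∏ j ∈ Finset.Ico i (n + 1), B (2 * j + 2) =
        (∑ i ∈ Finset.range (n + 1), A (2 * i) * (∏ j ∈ Finset.range i, B (2 * j + 1)) *
            ∏ j ∈ Finset.Ico i n, B (2 * j + 2)) * B (2 * n + 2) := by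
      rw [Finset.sum_mul]
      refine Finset.sum_congr rfl fun i hi => ?_
      rw [Finset.prod_Ico_succ_top (by simpa [Nat.lt_succ_iff] using hi), mul_assoc _ _ (B _)]
    rw [hrec (2 * (n + 1)) (by omega), show 2 * (n + 1) - 1 = 2 * n + 1 by omega,
      coeff_succ_of_three_term, three_term_recurrence_zero_A_terms A B c₀ P h0 hrec, ih,
      Finset.sum_range_succ _ (n + 1), hsum, Finset.Ico_self, Finset.prod_empty,
      show 2 * (n + 1) = 2 * n + 2 by ring]
    ring

/-- The part of the solution of the three-term recurrence relation containing exactly two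
`A`-factors: the coefficient of `t^2` in `P (2n+2)` is the double sum
`c₀ * Σ_{i₁=0}^{n} Σ_{i₂=i₁}^{n} A (2i₁) * A (2i₂+1) * (∏_{j=0}^{i₁-1} B (2j+1)) *
 (∏_{j=i₁}^{i₂-1} B (2j+2)) * (∏_{j=i₂}^{n-1} B (2j+3))`. -/
theorem three_term_recurrence_two_A_terms
    {R : Type*} [CommRing R] (A B : ℕ → R) (c₀ : R) (P : ℕ → Polynomial R)
    (h0 : P 0 = Polynomial.C c₀)
    (h1 : P 1 = Polynomial.X * Polynomial.C (A 0 * c₀))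
    (hrec : ∀ n, 1 ≤ n →
      P (n + 1) = Polynomial.X * Polynomial.C (A n) * P n + Polynomial.C (B n) * P (n - 1))
    (n : ℕ) :
    (P (2 * n + 2)).coeff 2 =
      c₀ * ∑ i₁ ∈ Finset.range (n + 1), ∑ i₂ ∈ Finset.Icc i₁ n,
        A (2 * i₁) * A (2 * i₂ + 1) *
          (∏ j ∈ Finset.range i₁, B (2 * j + 1)) *
          (∏ j ∈ Finset.Ico i₁ i₂, B (2 * j + 2)) *
          ∏ j ∈ Finset.Ico i₂ n, B (2 * j + 3) := by
  induction n with
  | zero =>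
    have h := three_term_recurrence_one_A_term A B c₀ P h0 h1 hrec 0
    rw [hrec (2 * 0 + 1) le_rfl, coeff_succ_of_three_term, h]
    simp [h0]
    ring
  | succ n ih =>
    have hsum : ∀ i ∈ Finset.range (n + 1 + 1), ∑ i₂ ∈ Finset.Icc i (n + 1),
          A (2 * i) * A (2 * i₂ + 1) *
            (∏ j ∈ Finset.range i, B (2 * j + 1)) *
            (∏ j ∈ Finset.Ico i i₂, B (2 * j + 2)) *
            ∏ j ∈ Finset.Ico i₂ (n + 1), B (2 * j + 3) =
        (∑ i₂ ∈ Finset.Icc i n, A (2 * i) * A (2 * i₂ + 1) *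
            (∏ j ∈ Finset.range i, B (2 * j + 1)) *
            (∏ j ∈ Finset.Ico i i₂, B (2 * j + 2)) *
            ∏ j ∈ Finset.Ico i₂ n, B (2 * j + 3)) * B (2 * n + 3) +
        (A (2 * i) * (∏ j ∈ Finset.range i, B (2 * j + 1)) *
          ∏ j ∈ Finset.Ico i (n + 1), B (2 * j + 2)) * A (2 * (n + 1) + 1) := by
      intro i hi
      rw [Finset.sum_Icc_succ_top (by simpa [Nat.lt_succ_iff] using hi), Finset.sum_mul,
        Finset.Ico_self, Finset.prod_empty]
      congr 1
      · refine Finset.sum_congr rfl fun k hk => ?_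
        rw [Finset.prod_Ico_succ_top (Finset.mem_Icc.1 hk).2, mul_assoc _ _ (B _)]
      · ring
    rw [hrec (2 * (n + 1) + 1) (by omega), Nat.add_sub_cancel, coeff_succ_of_three_term,
      three_term_recurrence_one_A_term A B c₀ P h0 h1 hrec, show 2 * (n + 1) = 2 * n + 2 by ring,
      ih, Finset.sum_congr rfl hsum, Finset.sum_add_distrib, ← Finset.sum_mul, ← Finset.sum_mul,
      Finset.sum_range_succ (fun i => ∑ i₂ ∈ Finset.Icc i n, _) (n + 1),
      Finset.Icc_eq_empty (by omega : ¬ n + 1 ≤ n), Finset.sum_empty, show 2 * (n + 1) = 2 * n + 2 by ring]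
    ring
end
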